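/- Let A = 1 + Σ_{n=1}^∞ A_n t^n be an m×m matrix with entries in Ω_an which becomes invertible over Γ_an,con. Then there exist a matrix B = 1 + Σ_{n=1}^∞ B_n t^n with entries in Ω_an which is invertible over Ω_an, and a matrix C with entries in Γ_con[1/p], such that A = BC. -/

import Mathlib

open scoped Classical

/-- The analytic setting.  `F = O[1/p]` is the fraction field of a complete discrete
valuation ring `O` which is a finite totally ramified extension of the Witt vectors of an
algebraically closed field `k` of characteristic `p` (encoded via the absolute value `abv`
with `abv p = 1/p`, discreteness, completeness, and algebraically closed residue field),
equipped with a Frobenius lift `σF`.  `Γac = Γ_{an,con}` is the ring of series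
`∑_{n ∈ ℤ} cₙ tⁿ` with `cₙ ∈ F` such that `limsup_{n→+∞} |cₙ|^{1/n} ≤ 1` and
`|cₙ| ≤ p^{cn+d}` for all `n < 0`, for some constants `c, d > 0`; it is encoded by its
coefficient functionals `coeff`, and carries the standard Frobenius `frob = σ_t`
(acting by `σ` on coefficients and sending `t` to `t^p`). -/
structure AnSetting (p : ℕ) [Fact p.Prime] where
  F : Type
  [fieldF : Field F]
  abv : F → ℝ
  abv_nonneg : ∀ x, 0 ≤ abv x
  abv_eq_zero : ∀ x, abv x = 0 ↔ x = 0
  abv_mul : ∀ x y, abv (x * y) = abv x * abv y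
  abv_add_le : ∀ x y, abv (x + y) ≤ max (abv x) (abv y)
  abv_p : abv (p : F) = (p : ℝ)⁻¹
  m : ℕ
  m_pos : 0 < m
  abv_discrete : ∀ x : F, x ≠ 0 → ∃ n : ℤ, abv x = (p : ℝ) ^ ((n : ℝ) / (m : ℝ))
  complete : ∀ f : ℕ → F,
    (∀ ε : ℝ, 0 < ε → ∃ N, ∀ a ≥ N, ∀ b ≥ N, abv (f a - f b) < ε) →
    ∃ x : F, ∀ ε : ℝ, 0 < ε → ∃ N, ∀ a ≥ N, abv (f a - x) < ε
  residue_algClosed : ∀ f : Polynomial F, f.Monic → (∀ i, abv (f.coeff i) ≤ 1) →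
    0 < f.natDegree → ∃ x : F, abv x ≤ 1 ∧ abv (Polynomial.eval x f) < 1
  σF : F ≃+* F
  abv_σF : ∀ x, abv (σF x) = abv x
  σF_frob : ∀ x : F, abv x ≤ 1 → abv (σF x - x ^ p) < 1
  Γac : Type
  [commΓac : CommRing Γac]
  coeff : Γac → ℤ → F
  coeff_injective : Function.Injective coeff
  coeff_add : ∀ x y i, coeff (x + y) i = coeff x i + coeff y i
  coeff_growth : ∀ (x : Γac) (ε : ℝ), 0 < ε → ∃ N : ℤ, 0 ≤ N ∧
    ∀ n : ℤ, N ≤ n → abv (coeff x n) ≤ (1 + ε) ^ n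
  coeff_decay : ∀ x : Γac, ∃ c d : ℝ, 0 < c ∧ 0 < d ∧
    ∀ n : ℤ, n < 0 → abv (coeff x n) ≤ (p : ℝ) ^ (c * (n : ℝ) + d)
  coeff_surjective : ∀ f : ℤ → F,
    (∀ ε : ℝ, 0 < ε → ∃ N : ℤ, 0 ≤ N ∧ ∀ n : ℤ, N ≤ n → abv (f n) ≤ (1 + ε) ^ n) →
    (∃ c d : ℝ, 0 < c ∧ 0 < d ∧ ∀ n : ℤ, n < 0 → abv (f n) ≤ (p : ℝ) ^ (c * (n : ℝ) + d)) →
    ∃ x, coeff x = f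
  coeff_one : ∀ i, coeff 1 i = if i = 0 then 1 else 0
  t : Γac
  coeff_t : ∀ i, coeff t i = if i = 1 then 1 else 0
  const : F →+* Γac
  coeff_const : ∀ a i, coeff (const a) i = if i = 0 then a else 0
  coeff_mul : ∀ (x y : Γac) (n : ℤ) (ε : ℝ), 0 < ε →
    ∃ S : Finset ℤ, ∀ T : Finset ℤ, S ⊆ T →
      abv (coeff (x * y) n - ∑ i ∈ T, coeff x i * coeff y (n - i)) < ε
  frob : Γac →+* Γac
  coeff_frob : ∀ x n, coeff (frob x) n =
    if (p : ℤ) ∣ n then σF (coeff x (n / (p : ℤ))) else 0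

attribute [instance] AnSetting.fieldF AnSetting.commΓac

namespace AnSetting

variable {p : ℕ} [Fact p.Prime] (S : AnSetting p)

/-- The subring `Ω_an ⊆ Γ_{an,con}` of rigid analytic functions on the open unit disc
(series with no negative-index coefficients), as a set. -/
def omegaAnSet : Set S.Γac := {x | ∀ i : ℤ, i < 0 → S.coeff x i = 0}

/-- The subring `Γ_con[1/p] ⊆ Γ_{an,con}`: the elements whose coefficients are bounded
above, as a set. -/
def conPSet : Set S.Γac := {x | ∃ C : ℝ, ∀ i : ℤ, S.abv (S.coeff x i) ≤ C}

/-- The subring `Γ_con ⊆ Γ_{an,con}`: the elements with integral coefficients, as a set. -/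
def conSet : Set S.Γac := {x | ∀ i : ℤ, S.abv (S.coeff x i) ≤ 1}

/-- The subring `Ω = O[[t]] ⊆ Γ_{an,con}`, as a set. -/
def omegaSet : Set S.Γac := {x | (∀ i : ℤ, S.abv (S.coeff x i) ≤ 1) ∧ ∀ i : ℤ, i < 0 → S.coeff x i = 0}

end AnSetting


namespace AnSetting

variable {p : ℕ} [Fact p.Prime] (S : AnSetting p)

lemma abv_zero' : S.abv 0 = 0 := (S.abv_eq_zero 0).2 rfl

lemma abv_pos' {x : S.F} (hx : x ≠ 0) : 0 < S.abv x :=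
  lt_of_le_of_ne (S.abv_nonneg x) (fun h => hx ((S.abv_eq_zero x).1 h.symm))

lemma abv_one' : S.abv 1 = 1 := by
  have h := S.abv_mul 1 1
  have h0 := S.abv_pos' (one_ne_zero)
  rw [mul_one] at h
  nlinarith

lemma abv_neg' (x : S.F) : S.abv (-x) = S.abv x := by
  have h1 : S.abv (-1) * S.abv (-1) = 1 := by
    rw [← S.abv_mul]; simp [S.abv_one']
  have h2 : S.abv (-1) = 1 := by
    have := S.abv_nonneg (-1)
    nlinarith
  rw [← neg_one_mul, S.abv_mul, h2, one_mul]

lemma abv_sub_le' {x y : S.F} {B : ℝ} (hx : S.abv x ≤ B) (hy : S.abv y ≤ B) :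
    S.abv (x - y) ≤ B := by
  rw [sub_eq_add_neg]
  exact (S.abv_add_le _ _).trans (max_le hx (by rwa [S.abv_neg']))

lemma abv_add_le' {x y : S.F} {B : ℝ} (hx : S.abv x ≤ B) (hy : S.abv y ≤ B) :
    S.abv (x + y) ≤ B :=
  (S.abv_add_le _ _).trans (max_le hx hy)

lemma abv_sum_le {ι : Type*} (T : Finset ι) (f : ι → S.F) {B : ℝ} (hB : 0 ≤ B)
    (h : ∀ i ∈ T, S.abv (f i) ≤ B) : S.abv (∑ i ∈ T, f i) ≤ B := by
  induction T using Finset.induction_on with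
  | empty => simpa [S.abv_zero'] using hB
  | insert a T ha ih =>
    rw [Finset.sum_insert ha]
    exact S.abv_add_le' (h a (by simp)) (ih fun i hi => h i (by simp [hi]))

lemma abv_inv' {x : S.F} (hx : x ≠ 0) : S.abv x⁻¹ = (S.abv x)⁻¹ := by
  have h : S.abv x * S.abv x⁻¹ = 1 := by rw [← S.abv_mul, mul_inv_cancel₀ hx, S.abv_one']
  exact eq_inv_of_mul_eq_one_right h

lemma eq_zero_of_abv_lt {x : S.F} (h : ∀ ε : ℝ, 0 < ε → S.abv x ≤ ε) : x = 0 := by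
  rw [← S.abv_eq_zero]
  exact le_antisymm (le_of_forall_pos_le_add fun ε hε => by simpa using h ε hε) (S.abv_nonneg x)

/-! Weierstrass division on sequences. -/

/-- the iteration map -/
noncomputable def wPhi (D : ℕ → S.F) (N : ℕ) (f q : ℕ → S.F) (n : ℕ) : S.F :=
  (D N)⁻¹ * (f (n + N) -
    ∑ ij ∈ (Finset.HasAntidiagonal.antidiagonal (n + N)).erase (N, n), D ij.1 * q ij.2)

lemma wPhi_sub (D : ℕ → S.F) (N : ℕ) (f q q' : ℕ → S.F) (n : ℕ) :
    S.wPhi D N f q n - S.wPhi D N f q' n =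
    (D N)⁻¹ * (∑ ij ∈ (Finset.HasAntidiagonal.antidiagonal (n + N)).erase (N, n), D ij.1 * (q' ij.2 - q ij.2)) := by
  simp only [wPhi, mul_sub, Finset.sum_sub_distrib]
  ring

lemma wSum_bound {D : ℕ → S.F} {N : ℕ} {r δ : ℝ} (hr : 0 < r) (hδ : 0 ≤ δ)
    (hD : D N ≠ 0) (hdom : ∀ i, i ≠ N → S.abv (D i) * r ^ i ≤ δ * (S.abv (D N) * r ^ N))
    {w : ℕ → S.F} {M : ℝ} (hM : 0 ≤ M) (hw : ∀ n, S.abv (w n) * r ^ n ≤ M) (n : ℕ) :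
    S.abv ((D N)⁻¹ * ∑ ij ∈ (Finset.HasAntidiagonal.antidiagonal (n + N)).erase (N, n), D ij.1 * w ij.2) * r ^ n
      ≤ δ * M := by
  have hDp := S.abv_pos' hD
  have hrn : 0 < r ^ n := pow_pos hr n
  have hrN : 0 < r ^ N := pow_pos hr N
  have key : S.abv (∑ ij ∈ (Finset.HasAntidiagonal.antidiagonal (n + N)).erase (N, n), D ij.1 * w ij.2)
      ≤ δ * M * S.abv (D N) / r ^ n := by
    apply S.abv_sum_le _ _ (by positivity)
    rintro ⟨i, j⟩ hij
    simp only [Finset.mem_erase, ne_eq, Prod.mk.injEq, Finset.HasAntidiagonal.mem_antidiagonal] at hij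
    have hi : i ≠ N := fun h => hij.1 ⟨h, by omega⟩
    rw [le_div_iff₀ hrn, S.abv_mul]
    have h1 := hdom i hi
    have h2 := hw j
    have h3 : (S.abv (D i) * r ^ i) * (S.abv (w j) * r ^ j) ≤
        (δ * (S.abv (D N) * r ^ N)) * M := by
      apply mul_le_mul h1 h2
      · exact mul_nonneg (S.abv_nonneg _) (by positivity)
      · positivity
    have h4 : r ^ i * r ^ j = r ^ n * r ^ N := by rw [← pow_add, ← pow_add, hij.2]
    refine le_of_mul_le_mul_right ?_ hrN
    calc S.abv (D i) * S.abv (w j) * r ^ n * r ^ N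
        = S.abv (D i) * S.abv (w j) * (r ^ i * r ^ j) := by rw [h4]; ring
      _ = (S.abv (D i) * r ^ i) * (S.abv (w j) * r ^ j) := by ring
      _ ≤ _ := h3
      _ = _ := by ring
  rw [S.abv_mul, S.abv_inv' hD]
  rw [le_div_iff₀ hrn] at key
  calc _ = (S.abv (D N))⁻¹ * (S.abv (∑ ij ∈ (Finset.HasAntidiagonal.antidiagonal (n + N)).erase (N, n), D ij.1 * w ij.2) * r ^ n) := by ring
    _ ≤ (S.abv (D N))⁻¹ * (δ * M * S.abv (D N)) := by gcongr
    _ = _ := by field_simp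

lemma wdiv {D : ℕ → S.F} {N : ℕ} {r δ : ℝ} (hr : 0 < r) (hδ : 0 ≤ δ) (hδ1 : δ < 1)
    (hD : D N ≠ 0) (hdom : ∀ i, i ≠ N → S.abv (D i) * r ^ i ≤ δ * (S.abv (D N) * r ^ N))
    (f : ℕ → S.F) {K : ℝ} (hK : 0 ≤ K) (hf : ∀ n, S.abv (f n) * r ^ n ≤ K) :
    ∃ q : ℕ → S.F, (∀ n, S.abv (q n) * r ^ n ≤ K / (S.abv (D N) * r ^ N)) ∧
      ∀ n, f (n + N) = ∑ ij ∈ Finset.HasAntidiagonal.antidiagonal (n + N), D ij.1 * q ij.2 := by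
  have hDp := S.abv_pos' hD
  have hrN : 0 < r ^ N := pow_pos hr N
  set M := K / (S.abv (D N) * r ^ N) with hMdef
  have hM : 0 ≤ M := by positivity
  -- bound of differences
  have hsub : ∀ q q' : ℕ → S.F, ∀ B : ℝ, 0 ≤ B → (∀ n, S.abv (q n - q' n) * r ^ n ≤ B) →
      ∀ n, S.abv (S.wPhi D N f q n - S.wPhi D N f q' n) * r ^ n ≤ δ * B := by
    intro q q' B hB h n
    rw [S.wPhi_sub]
    apply S.wSum_bound hr hδ hD hdom hB (w := fun j => q' j - q j)
    intro n
    rw [← S.abv_neg', neg_sub]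
    exact h n
  have hmulle : ∀ (x y : S.F) (B : ℝ) (n : ℕ), S.abv x * r ^ n ≤ B → S.abv y * r ^ n ≤ B →
      S.abv (x - y) * r ^ n ≤ B := by
    intro x y B n hx hy
    have hrn : 0 < r ^ n := pow_pos hr n
    rw [← le_div_iff₀ hrn] at *
    exact S.abv_sub_le' hx hy
  have h0 : ∀ n, S.abv (S.wPhi D N f (fun _ => 0) n) * r ^ n ≤ M := by
    intro n
    simp only [wPhi, mul_zero, Finset.sum_const_zero, sub_zero]
    rw [S.abv_mul, S.abv_inv' hD, hMdef, le_div_iff₀ (by positivity)]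
    have := hf (n + N)
    rw [pow_add] at this
    calc _ = S.abv (f (n + N)) * (r ^ n * r ^ N) := by field_simp
      _ ≤ K := this
  set u : ℕ → ℕ → S.F := fun k => (S.wPhi D N f)^[k] (fun _ => 0) with hu
  have husucc : ∀ k, u (k + 1) = S.wPhi D N f (u k) := by
    intro k
    simp only [hu, Function.iterate_succ_apply']
  have hstep : ∀ k n, S.abv (u (k + 1) n - u k n) * r ^ n ≤ δ ^ k * M := by
    intro k
    induction k with
    | zero =>
      intro n
      rw [husucc]
      simpa [hu] using h0 n
    | succ k ih =>
      intro n
      have := hsub (u (k + 1)) (u k) (δ ^ k * M) (by positivity) ih n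
      rw [husucc (k + 1)]
      nth_rewrite 2 [husucc k]
      rw [pow_succ]
      linarith
  have hcau : ∀ k l n, S.abv (u (k + l) n - u k n) * r ^ n ≤ δ ^ k * M := by
    intro k l n
    induction l with
    | zero => simp [S.abv_zero']; positivity
    | succ l ih =>
      have h1 : u (k + (l + 1)) n - u k n
          = (u (k + l + 1) n - u (k + l) n) - (u k n - u (k + l) n) := by
        rw [← add_assoc]; ring
      rw [h1]
      apply hmulle
      · refine (hstep (k + l) n).trans ?_
        apply mul_le_mul_of_nonneg_right _ hM
        exact pow_le_pow_of_le_one hδ hδ1.le (by omega)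
      · rw [← S.abv_neg', neg_sub]; exact ih
  have hsmall : ∀ ε : ℝ, 0 < ε → ∃ k, δ ^ k * M < ε := by
    intro ε hε
    have h := (tendsto_pow_atTop_nhds_zero_of_lt_one hδ hδ1).mul_const M
    rw [zero_mul] at h
    exact (h.eventually (gt_mem_nhds hε)).exists
  have hlim : ∀ n, ∃ x : S.F, ∀ ε : ℝ, 0 < ε → ∃ A, ∀ a ≥ A, S.abv (u a n - x) < ε := by
    intro n
    apply S.complete (fun a => u a n)
    intro ε hε
    have hrn : 0 < r ^ n := pow_pos hr n
    obtain ⟨k, hk⟩ := hsmall (ε * r ^ n) (by positivity)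
    refine ⟨k, fun a ha b hb => ?_⟩
    obtain ⟨a', rfl⟩ := Nat.exists_eq_add_of_le ha
    obtain ⟨b', rfl⟩ := Nat.exists_eq_add_of_le hb
    have h1 : u (k + a') n - u (k + b') n = (u (k + a') n - u k n) - (u (k + b') n - u k n) := by
      ring
    have := hmulle _ _ _ n (hcau k a' n) (hcau k b' n)
    rw [← h1] at this
    exact lt_of_mul_lt_mul_right (this.trans_lt hk) hrn.le
  choose q hq using hlim
  have hqu : ∀ k n, S.abv (q n - u k n) * r ^ n ≤ δ ^ k * M := by
    intro k n
    have hrn : 0 < r ^ n := pow_pos hr n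
    apply le_of_forall_pos_le_add
    intro ε hε
    obtain ⟨A, hA⟩ := hq n (ε / r ^ n) (by positivity)
    have h1 := (hA (k + A) (by omega)).le
    rw [le_div_iff₀ hrn] at h1
    have h2 := hcau k A n
    have h3 : q n - u k n = (u (k + A) n - u k n) - (u (k + A) n - q n) := by ring
    rw [h3]
    have hpos : 0 ≤ δ ^ k * M := by positivity
    apply hmulle <;> linarith
  have hfix : ∀ n, S.wPhi D N f q n = q n := by
    intro n
    have hrn : 0 < r ^ n := pow_pos hr n
    rw [← sub_eq_zero]
    apply S.eq_zero_of_abv_lt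
    intro ε hε
    obtain ⟨k, hk⟩ := hsmall (ε * r ^ n) (by positivity)
    have h1 := hsub q (u k) _ (by positivity) (hqu k) n
    have h2 := hqu (k + 1) n
    have h3 : S.wPhi D N f q n - q n =
      (S.wPhi D N f q n - S.wPhi D N f (u k) n) - (q n - u (k + 1) n) := by
      rw [husucc]; ring
    rw [h3]
    have hpos : 0 ≤ δ ^ k * M := by positivity
    have h4 : δ * (δ ^ k * M) ≤ δ ^ k * M := by nlinarith
    have h5 : δ ^ (k + 1) * M ≤ δ ^ k * M := by rw [pow_succ]; linarith
    have := hmulle _ _ _ n (h1.trans h4) (h2.trans h5)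
    exact le_of_mul_le_mul_right (this.trans hk.le) hrn
  refine ⟨q, ?_, ?_⟩
  · intro n
    simpa [hu] using hqu 0 n
  · intro n
    have h := hfix n
    rw [wPhi, inv_mul_eq_iff_eq_mul₀ hD] at h
    rw [← Finset.add_sum_erase (Finset.HasAntidiagonal.antidiagonal (n + N)) (fun ij => D ij.1 * q ij.2) (a := (N, n))
      (by simp [add_comm])]
    simp only
    rw [← h]; ring

/-! Coefficients. -/

lemma coeff_zero' (i : ℤ) : S.coeff 0 i = 0 := by
  have h := S.coeff_add 0 0 i
  rw [add_zero] at h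
  simpa using h

lemma coeff_neg' (x : S.Γac) (i : ℤ) : S.coeff (-x) i = - S.coeff x i := by
  have h := S.coeff_add (-x) x i
  rw [neg_add_cancel, S.coeff_zero'] at h
  exact eq_neg_of_add_eq_zero_left h.symm

lemma coeff_sub' (x y : S.Γac) (i : ℤ) : S.coeff (x - y) i = S.coeff x i - S.coeff y i := by
  rw [sub_eq_add_neg, S.coeff_add, S.coeff_neg', sub_eq_add_neg]

lemma coeff_mul_fin (x y : S.Γac) (n : ℤ) (T : Finset ℤ)
    (h : ∀ i, i ∉ T → S.coeff x i * S.coeff y (n - i) = 0) :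
    S.coeff (x * y) n = ∑ i ∈ T, S.coeff x i * S.coeff y (n - i) := by
  rw [← sub_eq_zero]
  apply S.eq_zero_of_abv_lt
  intro ε hε
  obtain ⟨U, hU⟩ := S.coeff_mul x y n ε hε
  have := hU (U ∪ T) Finset.subset_union_left
  rw [← Finset.sum_subset (Finset.subset_union_right : T ⊆ U ∪ T) (fun i _ hi => h i hi)] at this
  exact this.le

lemma coeff_mul_bound (x y : S.Γac) (n : ℤ) {B : ℝ}
    (h : ∀ i, S.abv (S.coeff x i) * S.abv (S.coeff y (n - i)) ≤ B) :
    S.abv (S.coeff (x * y) n) ≤ B := by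
  have hB : 0 ≤ B := (mul_nonneg (S.abv_nonneg _) (S.abv_nonneg _)).trans (h 0)
  apply le_of_forall_pos_le_add
  intro ε hε
  obtain ⟨U, hU⟩ := S.coeff_mul x y n ε hε
  have h1 := hU U subset_rfl
  have h2 : S.abv (∑ i ∈ U, S.coeff x i * S.coeff y (n - i)) ≤ B :=
    S.abv_sum_le _ _ hB fun i _ => by rw [S.abv_mul]; exact h i
  have h3 : S.coeff (x * y) n = (S.coeff (x * y) n - ∑ i ∈ U, S.coeff x i * S.coeff y (n - i))
    + ∑ i ∈ U, S.coeff x i * S.coeff y (n - i) := by ring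
  rw [h3]
  apply S.abv_add_le' <;> linarith

/-- `Ω_an` as a subring. -/
def Om : Subring S.Γac where
  carrier := S.omegaAnSet
  mul_mem' := by
    intro x y hx hy i hi
    rw [S.coeff_mul_fin x y i ∅]
    · simp
    · intro j _
      by_cases hj : j < 0
      · rw [hx j hj, zero_mul]
      · rw [hy (i - j) (by omega), mul_zero]
  one_mem' := by
    intro i hi
    rw [S.coeff_one, if_neg hi.ne]
  add_mem' := by
    intro x y hx hy i hi
    rw [S.coeff_add, hx i hi, hy i hi, add_zero]
  zero_mem' := fun i _ => S.coeff_zero' i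
  neg_mem' := by
    intro x hx i hi
    rw [S.coeff_neg', hx i hi, neg_zero]

lemma coeff_mul_Om {x y : S.Γac} (hx : x ∈ S.omegaAnSet) (hy : y ∈ S.omegaAnSet) (n : ℕ) :
    S.coeff (x * y) n = ∑ ij ∈ Finset.HasAntidiagonal.antidiagonal n,
      S.coeff x (ij.1 : ℤ) * S.coeff y (ij.2 : ℤ) := by
  rw [S.coeff_mul_fin x y n ((Finset.range (n + 1)).map ⟨fun k : ℕ => (k : ℤ), Nat.cast_injective⟩)]
  · rw [Finset.Nat.sum_antidiagonal_eq_sum_range_succ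
      (fun i j : ℕ => S.coeff x (i : ℤ) * S.coeff y (j : ℤ)) n, Finset.sum_map]
    apply Finset.sum_congr rfl
    intro i hi
    simp only [Finset.mem_range] at hi
    simp only [Function.Embedding.coeFn_mk]
    rw [Nat.cast_sub (by omega)]
  · intro i hi
    by_cases h0 : i < 0
    · rw [hx i h0, zero_mul]
    · have : ¬ i ≤ n := by
        intro hle
        apply hi
        simp only [Finset.mem_map, Finset.mem_range, Function.Embedding.coeFn_mk]
        exact ⟨i.toNat, by omega, by omega⟩
      rw [hy (n - i) (by omega), mul_zero]

lemma tendsto_coeff (x : S.Γac) {r : ℝ} (hr : 0 < r) (hr1 : r < 1) :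
    Filter.Tendsto (fun n : ℕ => S.abv (S.coeff x (n : ℤ)) * r ^ n) Filter.atTop (nhds 0) := by
  obtain ⟨ε, hε, hε1⟩ : ∃ ε : ℝ, 0 < ε ∧ (1 + ε) * r < 1 := by
    refine ⟨(1 - r) / 2, by linarith, by nlinarith⟩
  obtain ⟨N, hN, h⟩ := S.coeff_growth x ε hε
  apply squeeze_zero' (g := fun n : ℕ => ((1 + ε) * r) ^ n)
  · exact Filter.Eventually.of_forall fun n => mul_nonneg (S.abv_nonneg _) (by positivity)
  · filter_upwards [Filter.eventually_ge_atTop N.toNat] with n hn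
    rw [mul_pow]
    apply mul_le_mul_of_nonneg_right _ (by positivity)
    have := h n (by omega)
    rwa [zpow_natCast] at this
  · exact tendsto_pow_atTop_nhds_zero_of_lt_one (by positivity) hε1

lemma bdd_coeff (x : S.Γac) {r : ℝ} (hr : 0 < r) (hr1 : r < 1) :
    ∃ K : ℝ, 0 ≤ K ∧ ∀ n : ℕ, S.abv (S.coeff x (n : ℤ)) * r ^ n ≤ K := by
  obtain ⟨K, hK⟩ := (S.tendsto_coeff x hr hr1).bddAbove_range
  refine ⟨max K 0, le_max_right _ _, fun n => le_max_of_le_left (hK ⟨n, rfl⟩)⟩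

lemma exists_dom (u : ℕ → ℝ) (h0 : ∀ n, 0 ≤ u n)
    (hu : Filter.Tendsto u Filter.atTop (nhds 0)) (n₀ : ℕ) (hn₀ : 0 < u n₀)
    (hinj : ∀ i j, 0 < u i → u i = u j → i = j) :
    ∃ (N : ℕ) (δ : ℝ), 0 ≤ δ ∧ δ < 1 ∧ 0 < u N ∧ ∀ i, i ≠ N → u i ≤ δ * u N := by
  have h1 : ∀ᶠ n in Filter.atTop, u n < u n₀ / 2 := hu.eventually (gt_mem_nhds (by linarith))
  obtain ⟨M, hM⟩ := Filter.eventually_atTop.1 h1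
  have hn₀M : n₀ < M := by
    by_contra h
    have := hM n₀ (by omega)
    linarith
  obtain ⟨N, hNM, hN⟩ := Finset.exists_max_image (Finset.range M) u ⟨n₀, by simpa using hn₀M⟩
  have hNn : u n₀ ≤ u N := hN n₀ (by simpa using hn₀M)
  have hNpos : 0 < u N := by linarith
  have hlt : ∀ i, i ≠ N → u i < u N := by
    intro i hi
    by_cases hiM : i < M
    · refine lt_of_le_of_ne (hN i (by simpa using hiM)) fun h => hi ?_
      exact (hinj N i hNpos h.symm).symm
    · have := hM i (by omega)
      linarith
  by_cases hne : ((Finset.range M).erase N).Nonempty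
  · obtain ⟨L, hL, hLmax⟩ := Finset.exists_max_image _ u hne
    have hLN := hlt L (Finset.ne_of_mem_erase hL)
    refine ⟨N, max (1 / 2) (u L / u N), by positivity, max_lt (by norm_num) ?_, hNpos, ?_⟩
    · rwa [div_lt_one hNpos]
    · intro i hi
      rw [← div_le_iff₀ hNpos]
      by_cases hiM : i < M
      · apply le_max_of_le_right
        have := hLmax i (by simp [hi, hiM])
        gcongr
      · apply le_max_of_le_left
        have := hM i (by omega)
        rw [div_le_iff₀ hNpos]
        linarith
  · refine ⟨N, 1 / 2, by norm_num, by norm_num, hNpos, ?_⟩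
    intro i hi
    have hiM : ¬ i < M := fun h => hne ⟨i, by simp [hi, h]⟩
    have := hM i (by omega)
    linarith

/-- two terms at an irrational radius have distinct sizes -/
lemma irr_inj {s : ℝ} (hs : Irrational s) {x y : S.F} (hx : x ≠ 0) (hy : y ≠ 0) (i j : ℕ)
    (h : S.abv x * ((p : ℝ) ^ (-s)) ^ i = S.abv y * ((p : ℝ) ^ (-s)) ^ j) : i = j := by
  obtain ⟨a, ha⟩ := S.abv_discrete x hx
  obtain ⟨b, hb⟩ := S.abv_discrete y hy
  have hp1 : (1 : ℝ) < p := by exact_mod_cast (Fact.out : p.Prime).one_lt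
  have hp0 : (0 : ℝ) < p := by linarith
  rw [ha, hb, ← Real.rpow_mul_natCast hp0.le, ← Real.rpow_mul_natCast hp0.le,
    ← Real.rpow_add hp0, ← Real.rpow_add hp0] at h
  have h2 := (Real.rpow_right_inj hp0 hp1.ne').1 h
  by_contra hij
  have hm : (S.m : ℝ) ≠ 0 := by exact_mod_cast S.m_pos.ne'
  have hij' : ((i : ℝ) - j) ≠ 0 := by
    rw [sub_ne_zero]; exact_mod_cast hij
  apply hs
  refine ⟨((a - b : ℤ) : ℚ) / ((S.m : ℚ) * ((i : ℚ) - j)), ?_⟩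
  push_cast
  rw [div_eq_iff (by positivity)]
  field_simp at h2
  linarith

lemma dom_Om {x : S.Γac} (hx : x ∈ S.omegaAnSet) (hx0 : x ≠ 0) {s : ℝ} (hs : Irrational s)
    (hs0 : 0 < s) :
    ∃ (N : ℕ) (δ : ℝ), 0 ≤ δ ∧ δ < 1 ∧ S.coeff x (N : ℤ) ≠ 0 ∧ ∀ i : ℕ, i ≠ N →
      S.abv (S.coeff x (i : ℤ)) * ((p : ℝ) ^ (-s)) ^ i ≤
        δ * (S.abv (S.coeff x (N : ℤ)) * ((p : ℝ) ^ (-s)) ^ N) := by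
  have hp1 : (1 : ℝ) < p := by exact_mod_cast (Fact.out : p.Prime).one_lt
  have hp0 : (0 : ℝ) < p := by linarith
  have hr : 0 < (p : ℝ) ^ (-s) := Real.rpow_pos_of_pos hp0 _
  have hr1 : (p : ℝ) ^ (-s) < 1 := Real.rpow_lt_one_of_one_lt_of_neg hp1 (by linarith)
  have hne : ∀ n : ℕ, 0 < S.abv (S.coeff x (n : ℤ)) * ((p : ℝ) ^ (-s)) ^ n →
      S.coeff x (n : ℤ) ≠ 0 := by
    intro n hn h
    rw [h, S.abv_zero', zero_mul] at hn
    exact lt_irrefl _ hn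
  obtain ⟨n₀, hn₀⟩ : ∃ n : ℕ, S.coeff x (n : ℤ) ≠ 0 := by
    by_contra! hcon
    apply hx0
    apply S.coeff_injective
    funext i
    rw [S.coeff_zero']
    by_cases hi : i < 0
    · exact hx i hi
    · have := hcon i.toNat
      rwa [Int.toNat_of_nonneg (by omega)] at this
  obtain ⟨N, δ, h1, h2, h3, h4⟩ := exists_dom
    (fun n : ℕ => S.abv (S.coeff x (n : ℤ)) * ((p : ℝ) ^ (-s)) ^ n)
    (fun n => mul_nonneg (S.abv_nonneg _) (by positivity)) (S.tendsto_coeff x hr hr1) n₀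
    (mul_pos (S.abv_pos' hn₀) (by positivity)) (by
      intro i j hi hij
      exact S.irr_inj hs (hne i hi) (hne j (hij ▸ hi)) i j hij)
  exact ⟨N, δ, h1, h2, hne N h3, h4⟩

/-! Polynomials. -/

/-- polynomials inside `Γac` -/
noncomputable def iota : Polynomial S.F →+* S.Γac := Polynomial.eval₂RingHom S.const S.t

lemma coeff_t_mul (x : S.Γac) (n : ℤ) : S.coeff (S.t * x) n = S.coeff x (n - 1) := by
  rw [S.coeff_mul_fin _ _ n {1}]
  · simp [S.coeff_t]
  · intro i hi
    simp only [Finset.mem_singleton] at hi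
    simp [S.coeff_t, hi]

lemma coeff_const_mul (a : S.F) (x : S.Γac) (n : ℤ) :
    S.coeff (S.const a * x) n = a * S.coeff x n := by
  rw [S.coeff_mul_fin _ _ n {0}]
  · simp [S.coeff_const]
  · intro i hi
    simp only [Finset.mem_singleton] at hi
    simp [S.coeff_const, hi]

lemma coeff_t_pow (k : ℕ) (n : ℤ) : S.coeff (S.t ^ k) n = if n = k then 1 else 0 := by
  induction k generalizing n with
  | zero => simp [S.coeff_one]
  | succ k ih =>
    rw [pow_succ', S.coeff_t_mul, ih]
    push_cast
    congr 1
    apply propext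
    omega

lemma coeff_iota (P : Polynomial S.F) (n : ℤ) :
    S.coeff (S.iota P) n = if 0 ≤ n then P.coeff n.toNat else 0 := by
  induction P using Polynomial.induction_on' with
  | add P Q hP hQ =>
    rw [map_add, S.coeff_add, hP, hQ]
    split_ifs <;> simp
  | monomial k a =>
    rw [iota, Polynomial.coe_eval₂RingHom, Polynomial.eval₂_monomial, S.coeff_const_mul,
      S.coeff_t_pow, Polynomial.coeff_monomial]
    by_cases hn : 0 ≤ n
    · by_cases hk : n = k
      · subst hk; simp
      · have : ¬ k = n.toNat := by omega
        simp [hk, this]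
    · have : ¬ n = k := by omega
      simp [hn, this]

lemma iota_mem (P : Polynomial S.F) : S.iota P ∈ S.omegaAnSet := by
  intro i hi
  rw [S.coeff_iota, if_neg (by omega)]

lemma iota_bdd (P : Polynomial S.F) : S.iota P ∈ S.conPSet := by
  refine ⟨∑ k ∈ P.support, S.abv (P.coeff k), fun i => ?_⟩
  rw [S.coeff_iota]
  have hnn : 0 ≤ ∑ k ∈ P.support, S.abv (P.coeff k) :=
    Finset.sum_nonneg fun k _ => S.abv_nonneg _
  split_ifs with hi
  · by_cases h : P.coeff i.toNat = 0
    · rw [h, S.abv_zero']; exact hnn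
    · exact Finset.single_le_sum (f := fun k => S.abv (P.coeff k)) (fun k _ => S.abv_nonneg _)
        (Polynomial.mem_support_iff.2 h)
  · rw [S.abv_zero']; exact hnn

/-! Weierstrass division. -/

lemma mul_unique {d h x : S.Γac} (hd : d ∈ S.omegaAnSet) (hx : x ∈ S.omegaAnSet)
    (hdh : d * h = x) {N : ℕ} {r δ : ℝ} (hr : 0 < r) (hδ : 0 ≤ δ) (hδ1 : δ < 1)
    (hD : S.coeff d (N : ℤ) ≠ 0)
    (hdom : ∀ i : ℕ, i ≠ N → S.abv (S.coeff d (i : ℤ)) * r ^ i ≤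
      δ * (S.abv (S.coeff d (N : ℤ)) * r ^ N))
    {q : ℕ → S.F} {B : ℝ} (hB : 0 ≤ B) (hq : ∀ n, S.abv (q n) * r ^ n ≤ B)
    (hh : ∀ n : ℤ, S.abv (S.coeff h n) * r ^ n ≤ B)
    (hxq : ∀ n : ℕ, S.coeff x (n : ℤ) =
      ∑ ij ∈ Finset.HasAntidiagonal.antidiagonal n, S.coeff d (ij.1 : ℤ) * q ij.2) :
    ∀ n : ℤ, S.coeff h n = if 0 ≤ n then q n.toNat else 0 := by
  set g : ℤ → S.F := fun n => if 0 ≤ n then q n.toNat else 0 with hg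
  have hDp := S.abv_pos' hD
  have hgneg : ∀ n, n < 0 → g n = 0 := fun n hn => by simp [hg, hn]
  have hgnat : ∀ n : ℕ, g n = q n := fun n => by simp [hg]
  have hgB : ∀ n : ℤ, S.abv (g n) * r ^ n ≤ B := by
    intro n
    by_cases hn : n < 0
    · rw [hgneg n hn, S.abv_zero', zero_mul]; exact hB
    · obtain ⟨k, rfl⟩ := Int.eq_ofNat_of_zero_le (not_lt.1 hn)
      rw [hgnat, zpow_natCast]
      exact hq k
  have hdomZ : ∀ i : ℤ, i ≠ N → S.abv (S.coeff d i) * r ^ i ≤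
      δ * (S.abv (S.coeff d (N : ℤ)) * r ^ N) := by
    intro i hi
    by_cases hn : i < 0
    · rw [hd i hn, S.abv_zero', zero_mul]; positivity
    · obtain ⟨k, rfl⟩ := Int.eq_ofNat_of_zero_le (not_lt.1 hn)
      rw [zpow_natCast]
      exact hdom k (by exact_mod_cast hi)
  -- the finite convolution
  have hconv : ∀ n : ℤ, ∃ U : Finset ℤ, ∀ T : Finset ℤ, U ⊆ T →
      ∑ i ∈ T, S.coeff d i * g (n - i) = S.coeff x n := by
    intro n
    refine ⟨(Finset.range ((n + 1).toNat)).map ⟨fun k : ℕ => (k : ℤ), Nat.cast_injective⟩, ?_⟩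
    intro T hT
    rw [← Finset.sum_subset hT]
    · by_cases hn : n < 0
      · have : (n + 1).toNat = 0 := by omega
        rw [this]
        simp [hx n hn]
      · obtain ⟨k, rfl⟩ := Int.eq_ofNat_of_zero_le (not_lt.1 hn)
        have : ((k : ℤ) + 1).toNat = k + 1 := by omega
        rw [this, hxq k, Finset.Nat.sum_antidiagonal_eq_sum_range_succ
          (fun i j : ℕ => S.coeff d (i : ℤ) * q j) k, Finset.sum_map]
        apply Finset.sum_congr rfl
        intro i hi
        simp only [Finset.mem_range] at hi
        simp only [Function.Embedding.coeFn_mk]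
        rw [← hgnat, Nat.cast_sub (by omega)]
    · intro i _ hi
      by_cases h0 : i < 0
      · rw [hd i h0, zero_mul]
      · have : ¬ i ≤ n := by
          intro hle
          apply hi
          simp only [Finset.mem_map, Finset.mem_range, Function.Embedding.coeFn_mk]
          exact ⟨i.toNat, by omega, by omega⟩
        rw [hgneg (n - i) (by omega), mul_zero]
  have hw0 : ∀ n : ℤ, S.abv (S.coeff h n - g n) * r ^ n ≤ B := by
    intro n
    have hrn : 0 < r ^ n := zpow_pos hr n
    have h1 := hh n
    have h2 := hgB n
    rw [← le_div_iff₀ hrn] at *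
    exact S.abv_sub_le' h1 h2
  have hstep : ∀ b : ℝ, 0 ≤ b → (∀ n : ℤ, S.abv (S.coeff h n - g n) * r ^ n ≤ b) →
      ∀ n : ℤ, S.abv (S.coeff h n - g n) * r ^ n ≤ δ * b := by
    intro b hb hw M
    have hrM : 0 < r ^ M := zpow_pos hr M
    have hrN : 0 < r ^ N := pow_pos hr N
    have key : S.abv (S.coeff d (N : ℤ) * (S.coeff h M - g M)) ≤
        δ * S.abv (S.coeff d (N : ℤ)) * b / r ^ M := by
      apply le_of_forall_pos_le_add
      intro ε hε
      obtain ⟨U, hU⟩ := S.coeff_mul d h (N + M) ε hε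
      obtain ⟨V, hV⟩ := hconv (N + M)
      set T : Finset ℤ := insert (N : ℤ) (U ∪ V) with hTdef
      have hUT : U ⊆ T := fun i hi => by simp [hTdef, hi]
      have hVT : V ⊆ T := fun i hi => by simp [hTdef, hi]
      have hNT : (N : ℤ) ∈ T := by simp [hTdef]
      have h1 := hU T hUT
      have h2 := hV T hVT
      rw [hdh, ← h2, ← Finset.sum_sub_distrib] at h1
      have h3 : ∀ i : ℤ, S.coeff d i * g (N + M - i) - S.coeff d i * S.coeff h (N + M - i)
        = - (S.coeff d i * (S.coeff h (N + M - i) - g (N + M - i))) := fun i => by ring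
      simp only [h3, Finset.sum_neg_distrib] at h1
      rw [S.abv_neg', ← Finset.add_sum_erase T _ hNT, add_sub_cancel_left] at h1
      set Z := ∑ i ∈ T.erase (N : ℤ), S.coeff d i * (S.coeff h (N + M - i) - g (N + M - i)) with hZ
      have hZb : S.abv Z ≤ δ * S.abv (S.coeff d (N : ℤ)) * b / r ^ M := by
        apply S.abv_sum_le _ _ (by positivity)
        intro i hi
        have hiN := Finset.ne_of_mem_erase hi
        rw [le_div_iff₀ hrM, S.abv_mul]
        have h5 := mul_le_mul (hdomZ i hiN) (hw (N + M - i))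
          (mul_nonneg (S.abv_nonneg _) (zpow_pos hr _).le) (by positivity)
        have h6 : r ^ i * r ^ ((N : ℤ) + M - i) = r ^ N * r ^ M := by
          rw [← zpow_natCast, ← zpow_add₀ hr.ne', ← zpow_add₀ hr.ne']
          congr 1
          ring
        refine le_of_mul_le_mul_right ?_ hrN
        calc _ = S.abv (S.coeff d i) * S.abv (S.coeff h (N + M - i) - g (N + M - i)) *
              (r ^ N * r ^ M) := by ring
          _ = (S.abv (S.coeff d i) * r ^ i) *
              (S.abv (S.coeff h (N + M - i) - g (N + M - i)) * r ^ ((N : ℤ) + M - i)) := by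
            rw [← h6]; ring
          _ ≤ _ := h5
          _ = _ := by ring
      have h7 : S.coeff d (N : ℤ) * (S.coeff h M - g M) =
        (S.coeff d (N : ℤ) * (S.coeff h M - g M) + Z) - Z := by ring
      have hnn : 0 ≤ δ * S.abv (S.coeff d (N : ℤ)) * b / r ^ M := by positivity
      rw [h7]
      apply S.abv_sub_le' <;> linarith
    rw [S.abv_mul, le_div_iff₀ hrM] at key
    refine le_of_mul_le_mul_left ?_ hDp
    calc _ = S.abv (S.coeff d (N : ℤ)) * S.abv (S.coeff h M - g M) * r ^ M := by ring
      _ ≤ _ := key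
      _ = _ := by ring
  have hall : ∀ k : ℕ, ∀ n : ℤ, S.abv (S.coeff h n - g n) * r ^ n ≤ δ ^ k * B := by
    intro k
    induction k with
    | zero => simpa using hw0
    | succ k ih =>
      intro n
      have := hstep (δ ^ k * B) (by positivity) ih n
      rw [pow_succ]
      linarith
  intro n
  have hrn : 0 < r ^ n := zpow_pos hr n
  rw [← sub_eq_zero]
  apply S.eq_zero_of_abv_lt
  intro ε hε
  have hl := (tendsto_pow_atTop_nhds_zero_of_lt_one hδ hδ1).mul_const B
  rw [zero_mul] at hl
  obtain ⟨k, hk⟩ := (hl.eventually (gt_mem_nhds (show 0 < ε * r ^ n by positivity))).exists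
  exact le_of_mul_le_mul_right ((hall k n).trans hk.le) hrn

lemma division {d e : S.Γac} (hd : d ∈ S.omegaAnSet) (hde : d * e = 1) :
    ∃ (N : ℕ) (r : ℝ), 0 < r ∧ r < 1 ∧ ∀ f ∈ S.omegaAnSet, ∀ K : ℝ,
      (∀ n : ℕ, S.abv (S.coeff f (n : ℤ)) * r ^ n ≤ K) →
      ∃ g ∈ S.omegaAnSet, ∃ R : Polynomial S.F, f = d * g + S.iota R ∧ R.degree < N ∧
        ∀ i, S.abv (R.coeff i) * r ^ i ≤ K := by
  have hp1 : (1 : ℝ) < p := by exact_mod_cast (Fact.out : p.Prime).one_lt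
  have hp0 : (0 : ℝ) < p := by linarith
  obtain ⟨c, b, hc, hb, hdec⟩ := S.coeff_decay e
  obtain ⟨s, hs, hs0, hsc⟩ := exists_irrational_btwn hc
  have hd0 : d ≠ 0 := by
    rintro rfl
    have h1 := S.coeff_one 0
    rw [← hde, zero_mul, S.coeff_zero'] at h1
    simp at h1
  obtain ⟨N, δ, hδ, hδ1, hD, hdom⟩ := S.dom_Om hd hd0 hs hs0
  set r : ℝ := (p : ℝ) ^ (-s) with hrdef
  have hr : 0 < r := Real.rpow_pos_of_pos hp0 _
  have hr1 : r < 1 := Real.rpow_lt_one_of_one_lt_of_neg hp1 (by linarith)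
  have hDp := S.abv_pos' hD
  -- e is bounded at r
  obtain ⟨Ke, hKe0, hKe⟩ : ∃ Ke : ℝ, 0 ≤ Ke ∧ ∀ n : ℤ, S.abv (S.coeff e n) * r ^ n ≤ Ke := by
    obtain ⟨K1, hK10, hK1⟩ := S.bdd_coeff e hr hr1
    refine ⟨max K1 ((p : ℝ) ^ b), le_max_of_le_left hK10, fun n => ?_⟩
    by_cases hn : n < 0
    · apply le_max_of_le_right
      have h1 := hdec n hn
      have h2 : r ^ n = (p : ℝ) ^ (-s * n) := by
        rw [hrdef, ← Real.rpow_intCast, ← Real.rpow_mul hp0.le]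
      calc _ ≤ (p : ℝ) ^ (c * (n : ℝ) + b) * r ^ n :=
            mul_le_mul_of_nonneg_right h1 (zpow_pos hr n).le
        _ = (p : ℝ) ^ (c * (n : ℝ) + b + -s * n) := by rw [h2, ← Real.rpow_add hp0]
        _ ≤ (p : ℝ) ^ b := by
            apply Real.rpow_le_rpow_of_exponent_le hp1.le
            have : (n : ℝ) < 0 := by exact_mod_cast hn
            nlinarith
    · apply le_max_of_le_left
      obtain ⟨k, rfl⟩ := Int.eq_ofNat_of_zero_le (not_lt.1 hn)
      rw [zpow_natCast]
      exact hK1 k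
  refine ⟨N, r, hr, hr1, ?_⟩
  intro f hf K hK
  have hK0 : 0 ≤ K := (mul_nonneg (S.abv_nonneg _) (by positivity)).trans (hK 0)
  obtain ⟨q, hqb, hq⟩ := S.wdiv (D := fun i : ℕ => S.coeff d (i : ℤ)) hr hδ hδ1 hD hdom
    (fun n : ℕ => S.coeff f (n : ℤ)) hK0 hK
  set ρ : ℕ → S.F := fun i => S.coeff f (i : ℤ) -
    ∑ ij ∈ Finset.HasAntidiagonal.antidiagonal i, S.coeff d (ij.1 : ℤ) * q ij.2 with hρ
  set R : Polynomial S.F := ∑ i ∈ Finset.range N, Polynomial.monomial i (ρ i) with hR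
  have hRc : ∀ i, R.coeff i = if i < N then ρ i else 0 := by
    intro i
    simp [hR, Polynomial.finsetSum_coeff, Polynomial.coeff_monomial]
  have hρb : ∀ i, S.abv (ρ i) * r ^ i ≤ K := by
    intro i
    have hri : 0 < r ^ i := pow_pos hr i
    rw [← le_div_iff₀ hri]
    apply S.abv_sub_le'
    · rw [le_div_iff₀ hri]; exact hK i
    · apply S.abv_sum_le _ _ (by positivity)
      rintro ⟨a, j⟩ haj
      simp only [Finset.HasAntidiagonal.mem_antidiagonal] at haj
      rw [le_div_iff₀ hri, S.abv_mul, ← haj, pow_add]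
      have h1 : S.abv (S.coeff d (a : ℤ)) * r ^ a ≤ S.abv (S.coeff d (N : ℤ)) * r ^ N := by
        by_cases ha : a = N
        · rw [ha]
        · refine (hdom a ha).trans ?_
          have : 0 ≤ S.abv (S.coeff d (N : ℤ)) * r ^ N := by positivity
          nlinarith
      have h2 := mul_le_mul h1 (hqb j) (mul_nonneg (S.abv_nonneg _) (by positivity))
        (by positivity)
      calc _ = (S.abv (S.coeff d (a : ℤ)) * r ^ a) * (S.abv (q j) * r ^ j) := by ring
        _ ≤ _ := h2
        _ = K := by field_simp
  set x := f - S.iota R with hx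
  have hxΩ : x ∈ S.omegaAnSet := S.Om.sub_mem (x := f) hf (S.iota_mem R)
  have hdh : d * (e * x) = x := by rw [← mul_assoc, hde, one_mul]
  have hxq : ∀ n : ℕ, S.coeff x (n : ℤ) =
      ∑ ij ∈ Finset.HasAntidiagonal.antidiagonal n, S.coeff d (ij.1 : ℤ) * q ij.2 := by
    intro n
    rw [hx, S.coeff_sub', S.coeff_iota, if_pos (by omega), Int.toNat_natCast, hRc]
    by_cases hn : n < N
    · rw [if_pos hn, hρ]; ring
    · rw [if_neg hn, sub_zero]
      have := hq (n - N)
      rwa [Nat.sub_add_cancel (by omega)] at this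
  obtain ⟨Kx, hKx0, hKx⟩ := S.bdd_coeff x hr hr1
  have hKxZ : ∀ n : ℤ, S.abv (S.coeff x n) * r ^ n ≤ Kx := by
    intro n
    by_cases hn : n < 0
    · rw [hxΩ n hn, S.abv_zero', zero_mul]; exact hKx0
    · obtain ⟨k, rfl⟩ := Int.eq_ofNat_of_zero_le (not_lt.1 hn)
      rw [zpow_natCast]
      exact hKx k
  have hhb : ∀ n : ℤ, S.abv (S.coeff (e * x) n) * r ^ n ≤ Ke * Kx := by
    intro n
    have hrn : 0 < r ^ n := zpow_pos hr n
    rw [← le_div_iff₀ hrn]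
    apply S.coeff_mul_bound
    intro i
    rw [le_div_iff₀ hrn]
    have h1 := mul_le_mul (hKe i) (hKxZ (n - i))
      (mul_nonneg (S.abv_nonneg _) (zpow_pos hr _).le) hKe0
    have h2 : r ^ n = r ^ i * r ^ (n - i) := by
      rw [← zpow_add₀ hr.ne']; congr 1; ring
    rw [h2]
    linarith
  have hfin := S.mul_unique hd hxΩ hdh hr hδ hδ1 hD hdom
    (B := max (K / (S.abv (S.coeff d (N : ℤ)) * r ^ N)) (Ke * Kx)) (by positivity)
    (fun n => le_max_of_le_left (hqb n)) (fun n => le_max_of_le_right (hhb n)) hxq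
  refine ⟨e * x, ?_, R, ?_, ?_, ?_⟩
  · intro i hi
    rw [hfin, if_neg (by omega)]
  · rw [hdh, hx]; ring
  · rw [Polynomial.degree_lt_iff_coeff_zero]
    intro m hm
    rw [hRc, if_neg (by omega)]
  · intro i
    rw [hRc]
    split_ifs
    · exact hρb i
    · rw [S.abv_zero', zero_mul]; exact hK0

/-! Inverting the Weierstrass polynomial over `Γac`. -/

lemma poly_inv {P : Polynomial S.F} {N : ℕ} {r : ℝ} (hr : 0 < r) (hr1 : r < 1)
    (hPN : P.coeff N = 1) (hP0 : ∀ i, N < i → P.coeff i = 0)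
    (hPb : ∀ i, S.abv (P.coeff i) * r ^ i ≤ r ^ N) :
    ∃ e : S.Γac, S.iota P * e = 1 := by
  have hp1 : (1 : ℝ) < p := by exact_mod_cast (Fact.out : p.Prime).one_lt
  have hp0 : (0 : ℝ) < p := by linarith
  set Q : PowerSeries S.F := PowerSeries.mk (fun i => if i ≤ N then P.coeff (N - i) else 0) with hQ
  have hQ0 : PowerSeries.constantCoeff Q = 1 := by
    rw [← PowerSeries.coeff_zero_eq_constantCoeff_apply, hQ, PowerSeries.coeff_mk]
    simp [hPN]
  have hQb : ∀ i, S.abv (PowerSeries.coeff i Q) ≤ r ^ i := by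
    intro i
    rw [hQ, PowerSeries.coeff_mk]
    split_ifs with hi
    · have h1 := hPb (N - i)
      have h2 : r ^ N = r ^ i * r ^ (N - i) := by rw [← pow_add]; congr 1; omega
      rw [h2] at h1
      exact le_of_mul_le_mul_right h1 (pow_pos hr _)
    · rw [S.abv_zero']; positivity
  have hQinv : Q * Q⁻¹ = 1 := PowerSeries.mul_inv_cancel Q (by rw [hQ0]; exact one_ne_zero)
  set b : ℕ → S.F := fun n => PowerSeries.coeff n Q⁻¹ with hb
  have hconv : ∀ n : ℕ, ∑ ij ∈ Finset.HasAntidiagonal.antidiagonal n,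
      PowerSeries.coeff ij.1 Q * b ij.2 = if n = 0 then 1 else 0 := by
    intro n
    have := congrArg (PowerSeries.coeff n) hQinv
    rw [PowerSeries.coeff_mul, PowerSeries.coeff_one] at this
    exact this
  have hbb : ∀ n, S.abv (b n) ≤ r ^ n := by
    intro n
    induction n using Nat.strong_induction_on with
    | _ n ih =>
      have h1 := hconv n
      rw [← Finset.add_sum_erase _ _ (a := (0, n)) (by simp)] at h1
      simp only [PowerSeries.coeff_zero_eq_constantCoeff_apply, hQ0, one_mul] at h1
      have h2 := eq_sub_of_add_eq h1
      rw [h2]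
      apply S.abv_sub_le'
      · split_ifs with hn
        · rw [hn, S.abv_one', pow_zero]
        · rw [S.abv_zero']; positivity
      · apply S.abv_sum_le _ _ (by positivity)
        rintro ⟨i, j⟩ hij
        simp only [Finset.mem_erase, ne_eq, Prod.mk.injEq,
          Finset.HasAntidiagonal.mem_antidiagonal] at hij
        have hj : j < n := by
          by_contra hcon
          exact hij.1 ⟨by omega, by omega⟩
        rw [S.abv_mul, ← hij.2, pow_add]
        exact mul_le_mul (hQb i) (ih j hj) (S.abv_nonneg _) (by positivity)
  obtain ⟨e, he⟩ := S.coeff_surjective (fun n : ℤ => if n ≤ -N then b (-n - N).toNat else 0)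
    (by
      intro ε hε
      refine ⟨1, by norm_num, fun n hn => ?_⟩
      rw [if_neg (by omega), S.abv_zero']
      positivity)
    (by
      have hlp : 0 < Real.log p := Real.log_pos hp1
      have hlr : Real.log r < 0 := Real.log_neg hr hr1
      set s : ℝ := - Real.log r / Real.log p with hs
      have hs0 : 0 < s := div_pos (by linarith) hlp
      have hrs : r = (p : ℝ) ^ (-s) := by
        rw [Real.rpow_def_of_pos hp0, hs]
        have : Real.log p * -(-Real.log r / Real.log p) = Real.log r := by field_simp
        rw [this, Real.exp_log hr]
      refine ⟨s, s * N + 1, hs0, by positivity, fun n hn => ?_⟩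
      split_ifs with hnN
      · refine (hbb _).trans ?_
        rw [hrs, ← Real.rpow_mul_natCast hp0.le]
        apply Real.rpow_le_rpow_of_exponent_le hp1.le
        have h1 : (((-n - N).toNat : ℕ) : ℝ) = -n - N := by
          have : (((-n - N).toNat : ℕ) : ℤ) = -n - N := Int.toNat_of_nonneg (by omega)
          exact_mod_cast this
        rw [h1]
        linarith
      · rw [S.abv_zero']; positivity)
  have hec : ∀ n : ℤ, S.coeff e n = if n ≤ -N then b (-n - N).toNat else 0 := fun n => by rw [he]
  refine ⟨e, S.coeff_injective ?_⟩
  funext n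
  rw [S.coeff_one]
  have hPz : ∀ i : ℤ, (N : ℤ) < i → S.coeff (S.iota P) i = 0 := by
    intro i hi
    rw [S.coeff_iota, if_pos (by omega), hP0 _ (by omega)]
  by_cases hn : 0 < n
  · rw [S.coeff_mul_fin _ _ n ∅, if_neg hn.ne', Finset.sum_empty]
    intro i _
    by_cases hi : (N : ℤ) < i
    · rw [hPz i hi, zero_mul]
    · rw [hec, if_neg (by omega), mul_zero]
  · obtain ⟨k, hk⟩ := Int.eq_ofNat_of_zero_le (show 0 ≤ -n by omega)
    have hnk : n = -(k : ℤ) := by omega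
    subst hnk
    have hinj : Function.Injective (fun a : ℕ => (N : ℤ) - a) := by
      intro a c hac
      simp only at hac
      omega
    rw [S.coeff_mul_fin _ _ _ ((Finset.range (k + 1)).map ⟨fun a : ℕ => (N : ℤ) - a, hinj⟩)]
    · have h1 := hconv k
      rw [Finset.Nat.sum_antidiagonal_eq_sum_range_succ
        (fun i j : ℕ => PowerSeries.coeff i Q * b j) k] at h1
      have h2 : (if (-(k : ℤ)) = 0 then (1 : S.F) else 0) = if k = 0 then 1 else 0 := by
        by_cases hk0 : k = 0 <;> simp [hk0]
      rw [h2, ← h1, Finset.sum_map]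
      apply Finset.sum_congr rfl
      intro a ha
      simp only [Finset.mem_range] at ha
      simp only [Function.Embedding.coeFn_mk]
      rw [hec, if_pos (by omega), S.coeff_iota, hQ, PowerSeries.coeff_mk]
      congr 1
      · by_cases haN : a ≤ N
        · rw [if_pos (by omega), if_pos haN]
          congr 1
          omega
        · rw [if_neg (by omega), if_neg haN]
      · congr 1
        omega
    · intro i hi
      by_cases hiN : (N : ℤ) < i
      · rw [hPz i hiN, zero_mul]
      · rw [hec, if_neg, mul_zero]
        intro hle
        apply hi
        simp only [Finset.mem_map, Finset.mem_range, Function.Embedding.coeFn_mk]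
        exact ⟨(N - i).toNat, by omega, by omega⟩

lemma exists_poly {d e : S.Γac} (hd : d ∈ S.omegaAnSet) (hde : d * e = 1) :
    ∃ P : Polynomial S.F, P ≠ 0 ∧ (∃ q ∈ S.omegaAnSet, S.iota P = q * d) ∧
      ∀ f ∈ S.omegaAnSet, ∃ g ∈ S.omegaAnSet, ∃ R, f = S.iota P * g + S.iota R := by
  obtain ⟨N, r, hr, hr1, hdiv⟩ := S.division hd hde
  have hXc : ∀ n : ℕ, S.abv (S.coeff (S.iota (Polynomial.X ^ N)) (n : ℤ)) * r ^ n ≤ r ^ N := by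
    intro n
    rw [S.coeff_iota, if_pos (by omega), Int.toNat_natCast, Polynomial.coeff_X_pow]
    split_ifs with h
    · rw [h, S.abv_one', one_mul]
    · rw [S.abv_zero', zero_mul]; positivity
  obtain ⟨q, hq, R, hqR, hRdeg, hRb⟩ := hdiv _ (S.iota_mem (Polynomial.X ^ N)) _ hXc
  rw [Polynomial.degree_lt_iff_coeff_zero] at hRdeg
  set P : Polynomial S.F := Polynomial.X ^ N - R with hP
  have hPN : P.coeff N = 1 := by
    rw [hP, Polynomial.coeff_sub, hRdeg N le_rfl, Polynomial.coeff_X_pow]; simp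
  have hP0 : ∀ i, N < i → P.coeff i = 0 := by
    intro i hi
    rw [hP, Polynomial.coeff_sub, hRdeg i (by omega), Polynomial.coeff_X_pow, if_neg (by omega),
      sub_zero]
  have hPb : ∀ i, S.abv (P.coeff i) * r ^ i ≤ r ^ N := by
    intro i
    have hri := pow_pos hr i
    rw [hP, Polynomial.coeff_sub, ← le_div_iff₀ hri]
    apply S.abv_sub_le'
    · rw [le_div_iff₀ hri]
      have := hXc i
      rwa [S.coeff_iota, if_pos (by omega), Int.toNat_natCast] at this
    · rw [le_div_iff₀ hri]; exact hRb i
  obtain ⟨e', he'⟩ := S.poly_inv hr hr1 hPN hP0 hPb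
  obtain ⟨N', r', hr', hr1', hdiv'⟩ := S.division (S.iota_mem P) he'
  refine ⟨P, ?_, ⟨q, hq, ?_⟩, ?_⟩
  · intro h
    rw [h, Polynomial.coeff_zero] at hPN
    exact zero_ne_one hPN
  · rw [hP, map_sub, hqR]; ring
  · intro f hf
    obtain ⟨K, _, hK⟩ := S.bdd_coeff f hr' hr1'
    obtain ⟨g, hg, R', h, _⟩ := hdiv' f hf K hK
    exact ⟨g, hg, R', h⟩

end AnSetting

open Matrix in
lemma lattice_factor {K Ω : Type*} [Field K] [CommRing Ω] (ι : Polynomial K →+* Ω) {r : ℕ}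
    (A : Matrix (Fin r) (Fin r) Ω) (P : Polynomial K) (hP0 : P ≠ 0) (q : Ω)
    (hP : ι P = q * A.det) (hdiv : ∀ f : Ω, ∃ g R, f = ι P * g + ι R)
    (hreg : ∀ M M' : Matrix (Fin r) (Fin r) Ω, M * A = M' * A → M = M') :
    ∃ (B B' : Matrix (Fin r) (Fin r) Ω) (C : Matrix (Fin r) (Fin r) (Polynomial K)),
      A = B * C.map ι ∧ B * B' = 1 := by
  let L : Submodule (Polynomial K) (Fin r → Polynomial K) :=
    { carrier := {v | ∃ w : Fin r → Ω, (fun j => ι (v j)) = w ᵥ* A}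
      add_mem' := by
        rintro v v' ⟨w, hw⟩ ⟨w', hw'⟩
        refine ⟨w + w', ?_⟩
        rw [Matrix.add_vecMul, ← hw, ← hw']
        funext j
        simp
      zero_mem' := ⟨0, by funext j; simp⟩
      smul_mem' := by
        rintro c v ⟨w, hw⟩
        refine ⟨ι c • w, ?_⟩
        rw [Matrix.smul_vecMul, ← hw]
        funext j
        simp }
  have hadj : (q • A.adjugate) * A = ι P • (1 : Matrix (Fin r) (Fin r) Ω) := by
    rw [Matrix.smul_mul, Matrix.adjugate_mul, smul_smul, hP]
  have hPL : ∀ v : Fin r → Polynomial K, P • v ∈ L := by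
    intro v
    refine ⟨(fun j => ι (v j)) ᵥ* (q • A.adjugate), ?_⟩
    rw [Matrix.vecMul_vecMul, hadj, Matrix.vecMul_smul, Matrix.vecMul_one]
    funext j
    simp
  obtain ⟨n, b₀⟩ := Submodule.basisOfPid (Pi.basisFun (Polynomial K) (Fin r)) L
  have hn : n = r := by
    have h1 : Module.finrank (Polynomial K) L = n := by
      rw [Module.finrank_eq_card_basis b₀, Fintype.card_fin]
    have h2 : Module.finrank (Polynomial K) (Fin r → Polynomial K) = r := by simp
    have : Module.Finite (Polynomial K) L := Module.Finite.of_basis b₀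
    apply le_antisymm
    · rw [← h1]
      calc _ ≤ _ := Submodule.finrank_le L
        _ = r := h2
    · rw [← h1]
      nth_rewrite 1 [← h2]
      apply LinearMap.finrank_le_finrank_of_injective
        (f := LinearMap.codRestrict L (P • LinearMap.id) (fun v => hPL v))
      intro v v' hvv
      have h3 := congrArg Subtype.val hvv
      simp only [LinearMap.codRestrict_apply, LinearMap.smul_apply, LinearMap.id_apply] at h3
      exact smul_right_injective _ hP0 h3
  subst hn
  let C : Matrix (Fin n) (Fin n) (Polynomial K) := fun i j => (b₀ i : Fin n → Polynomial K) j
  have hspan : ∀ M : Matrix (Fin n) (Fin n) (Polynomial K), (∀ i, M i ∈ L) →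
      ∃ X : Matrix (Fin n) (Fin n) (Polynomial K), M = X * C := by
    intro M hM
    refine ⟨Matrix.of fun i k => b₀.repr ⟨M i, hM i⟩ k, ?_⟩
    ext1 i j
    have h := congrArg Subtype.val (b₀.sum_repr ⟨M i, hM i⟩)
    have h' := congrFun h j
    simp only at h'
    refine h'.symm.trans ?_
    rw [Matrix.mul_apply, Submodule.coe_sum, Finset.sum_apply]
    rfl
  have hrow : ∀ i, ∃ w : Fin n → Ω, (fun j => ι (C i j)) = w ᵥ* A := fun i => (b₀ i).2
  choose W hW using hrow
  have hCW : C.map ι = Matrix.of W * A := by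
    ext i j
    have := congrFun (hW i) j
    simpa [Matrix.mul_apply, Matrix.vecMul, dotProduct] using this
  choose g R hgR using fun i j => hdiv (A i j)
  have hA : A = ι P • Matrix.of g + (Matrix.of R).map ι := by
    ext i j
    simpa using hgR i j
  have hRL : ∀ i, (Matrix.of R) i ∈ L := by
    intro i
    have h1 : (Matrix.of R).map ι = (1 - Matrix.of g * (q • A.adjugate)) * A := by
      rw [sub_mul, mul_assoc, hadj, one_mul, Matrix.mul_smul, mul_one]
      exact eq_sub_of_add_eq' hA.symm
    refine ⟨(1 - Matrix.of g * (q • A.adjugate)) i, ?_⟩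
    funext j
    have := congrFun (congrFun h1 i) j
    simpa [Matrix.mul_apply, Matrix.vecMul, dotProduct] using this
  obtain ⟨Y, hY⟩ := hspan _ hRL
  obtain ⟨Z, hZ⟩ := hspan (P • (1 : Matrix (Fin n) (Fin n) (Polynomial K))) (fun i => hPL _)
  have hPZ : ι P • (1 : Matrix (Fin n) (Fin n) Ω) = Z.map ι * C.map ι := by
    rw [← Matrix.map_mul, ← hZ]
    ext i j
    by_cases hij : i = j <;> simp [Matrix.one_apply, hij]
  have hfac : A = (Matrix.of g * Z.map ι + Y.map ι) * C.map ι := by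
    rw [add_mul, mul_assoc, ← hPZ, ← Matrix.map_mul, ← hY, Matrix.mul_smul, mul_one]
    exact hA
  refine ⟨Matrix.of g * Z.map ι + Y.map ι, Matrix.of W, C, hfac, ?_⟩
  apply hreg
  rw [mul_assoc, ← hCW, one_mul]
  exact hfac.symm

/-- constant coefficient on `Ω_an` -/
def AnSetting.ev0 {p : ℕ} [Fact p.Prime] (S : AnSetting p) : S.Om →+* S.F where
  toFun x := S.coeff x.1 0
  map_one' := by simp [S.coeff_one]
  map_zero' := by simp [S.coeff_zero']
  map_add' x y := by simp [S.coeff_add]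
  map_mul' x y := by
    have h := S.coeff_mul_Om x.2 y.2 0
    simpa using h

/-- Let `A = 1 + ∑_{n≥1} Aₙ tⁿ` be an `m × m` matrix with entries in
`Ω_an` which becomes invertible over `Γ_{an,con}`.  Then there exist a matrix
`B = 1 + ∑_{n≥1} Bₙ tⁿ` with entries in `Ω_an` which is invertible over `Ω_an`, and a
matrix `C` with entries in `Γ_con[1/p]`, such that `A = B · C`. -/
theorem omegaAn_matrix_factorization {p : ℕ} [Fact p.Prime] (S : AnSetting p) {r : ℕ}
    (A : Matrix (Fin r) (Fin r) S.Γac)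
    (hAΩ : ∀ i j, A i j ∈ S.omegaAnSet)
    (hA0 : ∀ i j, S.coeff (A i j) 0 = if i = j then 1 else 0)
    (hAinv : IsUnit A) :
    ∃ B C : Matrix (Fin r) (Fin r) S.Γac,
      -- `B` has entries in `Ω_an` and constant term the identity matrix
      (∀ i j, B i j ∈ S.omegaAnSet) ∧
      (∀ i j, S.coeff (B i j) 0 = if i = j then 1 else 0) ∧
      -- `B` is invertible over `Ω_an`
      (∃ B' : Matrix (Fin r) (Fin r) S.Γac, (∀ i j, B' i j ∈ S.omegaAnSet) ∧
        B * B' = 1 ∧ B' * B = 1) ∧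
      -- `C` has entries in `Γ_con[1/p]`
      (∀ i j, C i j ∈ S.conPSet) ∧
      A = B * C := by
  classical
  let ι : Polynomial S.F →+* S.Om := S.iota.codRestrict S.Om S.iota_mem
  let A' : Matrix (Fin r) (Fin r) S.Om := Matrix.of fun i j => ⟨A i j, hAΩ i j⟩
  have hAA' : S.Om.subtype.mapMatrix A' = A := by ext i j; rfl
  have hdet : S.Om.subtype A'.det = A.det := by rw [RingHom.map_det, hAA']
  obtain ⟨e, he⟩ := ((Matrix.isUnit_iff_isUnit_det A).1 hAinv).exists_right_inv
  have hdΩ : A.det ∈ S.omegaAnSet := by rw [← hdet]; exact A'.det.2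
  obtain ⟨P, hP0, ⟨q, hq, hPq⟩, hdiv⟩ := S.exists_poly hdΩ he
  obtain ⟨B, B', C, hABC, hBB'⟩ := lattice_factor ι A' P hP0 ⟨q, hq⟩
    (by
      apply Subtype.ext
      change S.iota P = q * S.Om.subtype A'.det
      rw [hdet, hPq])
    (by
      intro f
      obtain ⟨g, hg, R, h⟩ := hdiv f.1 f.2
      exact ⟨⟨g, hg⟩, R, Subtype.ext h⟩)
    (by
      intro M M' hM
      have h1 := congrArg S.Om.subtype.mapMatrix hM
      rw [map_mul, map_mul, hAA'] at h1
      have h2 := hAinv.mul_right_cancel h1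
      ext i j
      exact congrFun (congrFun h2 i) j)
  have hB'B : B' * B = 1 := mul_eq_one_comm.1 hBB'
  have hA0' : S.ev0.mapMatrix A' = 1 := by
    ext i j
    rw [Matrix.one_apply]
    exact hA0 i j
  let B0 : Matrix (Fin r) (Fin r) S.F := S.ev0.mapMatrix B
  let C0 : Matrix (Fin r) (Fin r) S.F := S.ev0.mapMatrix (ι.mapMatrix C)
  have hBC0 : B0 * C0 = 1 := by
    change S.ev0.mapMatrix B * S.ev0.mapMatrix (ι.mapMatrix C) = 1
    rw [← map_mul, ← hA0', hABC]
    rfl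
  have hCB0 : C0 * B0 = 1 := mul_eq_one_comm.1 hBC0
  let κ : S.F →+* S.Om := ι.comp Polynomial.C
  have hκ : ∀ a, S.ev0 (κ a) = a := by
    intro a
    change S.coeff (S.iota (Polynomial.C a)) 0 = a
    rw [S.coeff_iota]
    simp
  have hκm : ∀ M : Matrix (Fin r) (Fin r) S.F, S.ev0.mapMatrix (κ.mapMatrix M) = M := by
    intro M
    ext i j
    exact hκ _
  have hκBC : κ.mapMatrix B0 * κ.mapMatrix C0 = 1 := by rw [← map_mul, hBC0, map_one]
  have hκCB : κ.mapMatrix C0 * κ.mapMatrix B0 = 1 := by rw [← map_mul, hCB0, map_one]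
  let φ := S.Om.subtype.mapMatrix (m := Fin r)
  have hB1 : (B * κ.mapMatrix C0) * (κ.mapMatrix B0 * B') = 1 := by
    rw [mul_assoc, ← mul_assoc (κ.mapMatrix C0), hκCB, one_mul, hBB']
  have hB2 : (κ.mapMatrix B0 * B') * (B * κ.mapMatrix C0) = 1 := mul_eq_one_comm.1 hB1
  refine ⟨φ (B * κ.mapMatrix C0), φ (ι.mapMatrix ((Polynomial.C : S.F →+* _).mapMatrix B0 * C)),
    ?_, ?_, ⟨φ (κ.mapMatrix B0 * B'), ?_, ?_, ?_⟩, ?_, ?_⟩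
  · exact fun i j => ((B * κ.mapMatrix C0) i j).2
  · intro i j
    have h : S.ev0.mapMatrix (B * κ.mapMatrix C0) = 1 := by
      rw [map_mul, hκm]; exact hBC0
    have h' := congrFun (congrFun h i) j
    rw [Matrix.one_apply] at h'
    exact h'
  · exact fun i j => ((κ.mapMatrix B0 * B') i j).2
  · rw [← map_mul, hB1, map_one]
  · rw [← map_mul, hB2, map_one]
  · exact fun i j => S.iota_bdd _
  · rw [← map_mul, map_mul ι.mapMatrix]
    have h1 : ι.mapMatrix ((Polynomial.C : S.F →+* _).mapMatrix B0) = κ.mapMatrix B0 := by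
      ext i j; rfl
    rw [h1, mul_assoc, ← mul_assoc (κ.mapMatrix C0), hκCB, one_mul]
    rw [← hAA']
    change _ = S.Om.subtype.mapMatrix (B * C.map ι)
    rw [← hABC]
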